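/- arXiv:math/0607139 — 2 statements merged into one kernel-verified Lean document; each statement's English description precedes it below -/
import Mathlib

section
/- Let 𝒜 be a finite length, piecewise hereditary abelian category. Assume that there exist an integer r ≥ 1, a sign sequence ε = (ε₀,…,ε_{r−1}) ∈ {+1,−1}^r, and an indecomposable object Q₀ of 𝒜 such that for every indecomposable object Q of 𝒜 there exists an ε-path from Q₀ to Q. Then gldim 𝒜 ≤ r+1, and moreover projd_𝒜 Q + injd_𝒜 Q ≤ r+2 for every indecomposable object Q of 𝒜. -/
/-!
Statement 0 (Ladkani, "Bounds on the global dimension of certain piecewise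
hereditary categories", Theorem 1):

Let 𝒜 be a finite length, piecewise hereditary abelian category.  Assume that
there exist an integer r ≥ 1, a sign sequence ε ∈ {+1,−1}^r and an
indecomposable Q₀ such that every indecomposable Q of 𝒜 is the end of an
ε-path from Q₀.  Then gldim 𝒜 ≤ r+1 and projd Q + injd Q ≤ r+2 for every
indecomposable Q.
-/

open CategoryTheory CategoryTheory.Limits

universe w w' v u v' u'

namespace PiecewiseHereditaryPaper

variable (𝒜 : Type u) [Category.{v} 𝒜] [Abelian 𝒜] [HasDerivedCategory.{w} 𝒜]

/-- `Ext^d_𝒜(X,Y) ≠ 0`, where `Ext^d` is computed as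
`Hom_{D(𝒜)}(X[0], Y[0][d])`. -/
def extNonzero (X Y : 𝒜) (d : ℤ) : Prop :=
  ∃ g : (DerivedCategory.singleFunctor 𝒜 0).obj X ⟶
      (((DerivedCategory.singleFunctor 𝒜 0).obj Y)⟦d⟧), g ≠ 0

/-- The projective dimension `projd_𝒜 Q = sup {d : Ext^d_𝒜(Q,Q') ≠ 0 for some Q'}`,
as an element of `ℕ∞` (the empty sup being `0`). -/
noncomputable def projDim (Q : 𝒜) : ℕ∞ :=
  ⨆ (d : ℕ) (_ : ∃ Q' : 𝒜, extNonzero 𝒜 Q Q' d), (d : ℕ∞)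

/-- The injective dimension `injd_𝒜 Q = sup {d : Ext^d_𝒜(Q',Q) ≠ 0 for some Q'}`. -/
noncomputable def injDim (Q : 𝒜) : ℕ∞ :=
  ⨆ (d : ℕ) (_ : ∃ Q' : 𝒜, extNonzero 𝒜 Q' Q d), (d : ℕ∞)

/-- The global dimension `gldim 𝒜 = sup_Q projd_𝒜 Q`. -/
noncomputable def gldim : ℕ∞ := ⨆ Q : 𝒜, projDim 𝒜 Q

/-- An abelian category is hereditary if `Ext^d` vanishes for all `d ≥ 2`. -/
def Hereditary : Prop := ∀ (X Y : 𝒜) (d : ℕ), 2 ≤ d → ¬ extNonzero 𝒜 X Y (d : ℤ)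

/-- An abelian category has finite length if every object has a (finite)
composition series, i.e. a finite maximal chain of subobjects from `⊥` to `⊤`. -/
def FiniteLength : Prop :=
  ∀ X : 𝒜, ∃ (n : ℕ) (f : Fin (n + 1) → Subobject X),
    f 0 = ⊥ ∧ f (Fin.last n) = ⊤ ∧ ∀ i : Fin n, f i.castSucc ⋖ f i.succ

/-- A triangulated equivalence `D(𝒜) ≃ D(ℋ)`: an equivalence of categories
commuting with the shift and preserving distinguished triangles. -/
structure TriangulatedEquivalence (ℋ : Type u') [Category.{v'} ℋ] [Abelian ℋ]
    [HasDerivedCategory.{w'} ℋ] where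
  functor : DerivedCategory 𝒜 ⥤ DerivedCategory ℋ
  isEquivalence : functor.IsEquivalence
  commShift : functor.CommShift ℤ
  isTriangulated : letI := commShift; functor.IsTriangulated

/-- `𝒜` is piecewise hereditary if there are a hereditary abelian category `ℋ`
and a triangulated equivalence `D(𝒜) ≃ D(ℋ)`. -/
def IsPiecewiseHereditary : Prop :=
  ∃ (ℋ : Type u') (_ : Category.{v'} ℋ) (_ : Abelian ℋ) (_ : HasDerivedCategory.{w'} ℋ),
    Hereditary ℋ ∧ Nonempty (TriangulatedEquivalence 𝒜 ℋ)

/-- An `ε`-path from `Q` to `Q'` in the graph `G(𝒜)` of indecomposables of `𝒜`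
(edges `X → Y` whenever `Hom_𝒜(X,Y) ≠ 0`). -/
def EpsPath {r : ℕ} (ε : Fin r → ℤ) (Q Q' : 𝒜) : Prop :=
  ∃ c : Fin (r + 1) → 𝒜,
    c 0 = Q ∧ c (Fin.last r) = Q' ∧ (∀ i, Indecomposable (c i)) ∧
    ∀ i : Fin r,
      (ε i = 1 → ∃ g : c i.castSucc ⟶ c i.succ, g ≠ 0) ∧
      (ε i = -1 → ∃ g : c i.succ ⟶ c i.castSucc, g ≠ 0)

section Brutal

open ZeroObject

variable {C : Type u} [Category.{v} C] [Abelian C] (P : CochainComplex C ℤ)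
  (p : ℤ → Prop)

open Classical in
/-- Terms of the brutal truncation: keep the terms in the degrees satisfying `p`. -/
noncomputable def bX (i : ℤ) : C := if p i then P.X i else 0

open Classical in
/-- The inclusion of the terms. -/
noncomputable def bι (i : ℤ) : bX P p i ⟶ P.X i :=
  if h : p i then eqToHom (by simp [bX, h]) else 0

open Classical in
/-- The projection onto the terms. -/
noncomputable def bπ (i : ℤ) : P.X i ⟶ bX P p i :=
  if h : p i then eqToHom (by simp [bX, h]) else 0

lemma bX_isZero (i : ℤ) (h : ¬ p i) : IsZero (bX P p i) := by
  simp only [bX, h, if_false]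
  exact isZero_zero C

lemma bι_bπ (i : ℤ) : bι P p i ≫ bπ P p i = 𝟙 _ := by
  by_cases h : p i
  · simp [bι, bπ, h]
  · exact (bX_isZero P p i h).eq_of_src _ _

lemma bπ_bι (i : ℤ) (h : p i) : bπ P p i ≫ bι P p i = 𝟙 _ := by
  simp [bι, bπ, h]

lemma bπ_zero (i : ℤ) (h : ¬ p i) : bπ P p i = 0 := by
  simp [bπ, h]

lemma bι_zero (i : ℤ) (h : ¬ p i) : bι P p i = 0 := by
  simp [bι, h]

/-- The brutal truncation of a complex. -/
noncomputable def brutal : CochainComplex C ℤ where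
  X := bX P p
  d i j := bι P p i ≫ P.d i j ≫ bπ P p j
  shape i j h := by simp [P.shape i j h]
  d_comp_d' i j k _ _ := by
    by_cases h : p j
    · simp only [Category.assoc, reassoc_of% (bπ_bι P p j h), P.d_comp_d_assoc]
      simp
    · simp [bπ_zero P p j h]

/-- The inclusion of the brutal truncation. -/
noncomputable def brutalι (hp : ∀ i, p i → p (i + 1)) : brutal P p ⟶ P where
  f := bι P p
  comm' i j hij := by
    obtain rfl : i + 1 = j := hij
    by_cases h : p i
    · simp [brutal, bπ_bι P p (i + 1) (hp i h)]
    · exact (bX_isZero P p i h).eq_of_src _ _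

/-- The projection to the brutal truncation. -/
noncomputable def brutalπ (hp : ∀ i, p (i + 1) → p i) : P ⟶ brutal P p where
  f := bπ P p
  comm' i j hij := by
    obtain rfl : i + 1 = j := hij
    by_cases h : p (i + 1)
    · simp [brutal, reassoc_of% (bπ_bι P p i (hp i h))]
    · exact (bX_isZero P p (i + 1) h).eq_of_tgt _ _

lemma exists_brutal_ses (n m : ℤ) (hm : n + 1 = m) :
    ∃ (S : ShortComplex (CochainComplex C ℤ)) (_ : S.ShortExact) (_ : S.X₂ = P),
      S.X₁.IsStrictlyGE m ∧ S.X₃.IsStrictlyLE n := by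
  subst hm
  let f := brutalι P (fun i => n < i) (fun i hi => by lia)
  let g := brutalπ P (fun i => i ≤ n) (fun i hi => by lia)
  have w : f ≫ g = 0 := by
    ext i
    by_cases h : i ≤ n
    · exact (bX_isZero P (fun i => n < i) i (by simpa using h)).eq_of_src _ _
    · exact (bX_isZero P (fun i => i ≤ n) i h).eq_of_tgt _ _
  refine ⟨ShortComplex.mk f g w, ?_, rfl, ?_, ?_⟩
  · apply HomologicalComplex.shortExact_of_degreewise_shortExact
    intro i
    apply ShortComplex.Splitting.shortExact
    refine { r := bπ P (fun i => n < i) i, s := bι P (fun i => i ≤ n) i, f_r := ?_, s_g := ?_, id := ?_ }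
    · exact bι_bπ P _ i
    · exact bι_bπ P _ i
    · change bπ P (fun i => n < i) i ≫ bι P (fun i => n < i) i +
        bπ P (fun i => i ≤ n) i ≫ bι P (fun i => i ≤ n) i = 𝟙 (P.X i)
      by_cases h : i ≤ n
      · rw [bπ_bι P (fun i => i ≤ n) i h, bπ_zero P (fun i => n < i) i (by simpa using h)]
        simp
      · rw [bπ_bι P (fun i => n < i) i (by simpa using h), bπ_zero P (fun i => i ≤ n) i h]
        simp
  · rw [CochainComplex.isStrictlyGE_iff]
    intro i hi
    exact bX_isZero P (fun i => n < i) i (by lia)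
  · rw [CochainComplex.isStrictlyLE_iff]
    intro i hi
    exact bX_isZero P (fun i => i ≤ n) i (by lia)

end Brutal

section Hered

open DerivedCategory Pretriangulated

variable {C : Type u} [Category.{v} C] [Abelian C] [HasDerivedCategory.{w} C]

/-- Shifting single complexes. -/
noncomputable def singleShift (n a b : ℤ) (h : n + a = b) (X : C) :
    ((singleFunctor C b).obj X)⟦n⟧ ≅ (singleFunctor C a).obj X :=
  ((singleFunctors C).shiftIso n a b h).app X

lemma hom_single_zero (hH : Hereditary C) (A B : C) (i j : ℤ) (hij : j + 2 ≤ i)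
    (f : (singleFunctor C i).obj A ⟶ (singleFunctor C j).obj B) : f = 0 := by
  obtain ⟨d, hd⟩ := Int.eq_ofNat_of_zero_le (show 0 ≤ i - j by lia)
  have h0 := hH A B d (by lia)
  simp only [extNonzero, not_exists, not_not] at h0
  let e : ((singleFunctor C j).obj B)⟦i⟧ ≅ ((singleFunctor C 0).obj B)⟦(d : ℤ)⟧ :=
    singleShift i (j - i) j (by lia) B ≪≫ (singleShift (d : ℤ) (j - i) 0 (by lia) B).symm
  have h1 := h0 ((singleShift i 0 i (by lia) A).inv ≫ f⟦i⟧' ≫ e.hom)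
  rw [← cancel_epi (singleShift i 0 i (by lia) A).hom, ← cancel_mono e.inv] at h1
  simp only [Category.assoc, Iso.hom_inv_id_assoc, Iso.hom_inv_id, Category.comp_id,
    comp_zero, zero_comp] at h1
  exact (shiftFunctor (DerivedCategory C) i).map_injective (by simpa using h1)

lemma isGE_shift_one (X : DerivedCategory C) (n m : ℤ) (h : m + 1 = n) (hX : X.IsGE n) :
    (X⟦(1 : ℤ)⟧).IsGE m := TStructure.t.isGE_shift X n 1 m (by lia)

lemma isLE_shift_one (X : DerivedCategory C) (n m : ℤ) (h : m + 1 = n) (hX : X.IsLE n) :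
    (X⟦(1 : ℤ)⟧).IsLE m := TStructure.t.isLE_shift X n 1 m (by lia)

/-- objects between two objects in a distinguished triangle -/
lemma isGE₂ (T : Triangle (DerivedCategory C)) (hT : T ∈ distTriang _) (n : ℤ)
    (h₁ : T.obj₁.IsGE n) (h₃ : T.obj₃.IsGE n) : T.obj₂.IsGE n := by
  rw [isGE_iff] at *
  intro i hi
  exact (HomologySequence.exact₂ T hT i).isZero_of_both_zeros
    ((h₁ i hi).eq_of_src _ _) ((h₃ i hi).eq_of_tgt _ _)

lemma isLE₂ (T : Triangle (DerivedCategory C)) (hT : T ∈ distTriang _) (n : ℤ)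
    (h₁ : T.obj₁.IsLE n) (h₃ : T.obj₃.IsLE n) : T.obj₂.IsLE n := by
  rw [isLE_iff] at *
  intro i hi
  exact (HomologySequence.exact₂ T hT i).isZero_of_both_zeros
    ((h₁ i hi).eq_of_src _ _) ((h₃ i hi).eq_of_tgt _ _)

/-- In a hereditary category, there are no nonzero maps from an object in degree `i`
to a complex living in degrees `≤ i - 2`. -/
lemma hom_from_single_zero (hH : Hereditary C) (A : C) (i : ℤ) (Y : DerivedCategory C)
    (hY : Y.IsLE (i - 2)) (f : (singleFunctor C i).obj A ⟶ Y) : f = 0 := by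
  obtain ⟨K, hK, ⟨e⟩⟩ := exists_iso_Q_obj_of_isLE Y (i - 2)
  let e0 : (singleFunctor C i).obj A ≅ Q.obj ((CochainComplex.singleFunctor C i).obj A) :=
    (singleFunctorIsoCompQ C i).app A
  rw [← cancel_mono e.hom, zero_comp, ← cancel_epi e0.inv, comp_zero]
  generalize e0.inv ≫ f ≫ e.hom = φ
  obtain ⟨P, hP, s, hs, g, rfl⟩ := right_fac_of_isStrictlyLE φ i
  have hPi : (Q.obj P).IsGE i :=
    TStructure.t.isGE_of_iso (asIso (Q.map s)).symm i
  obtain ⟨S, hS, rfl, h₁, h₃⟩ := exists_brutal_ses P (i - 2) (i - 1) (by lia)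
  have hT := triangleOfSES_distinguished hS
  have hG : (Q.obj S.X₃).IsGE (i - 2) := by
    refine isGE₂ _ (rot_of_distTriang _ hT) (i - 2) ?_ ?_
    · exact TStructure.t.isGE_of_ge (Q.obj S.X₂) (i - 2) i
    · exact isGE_shift_one (Q.obj S.X₁) (i - 1) (i - 2) (by lia) inferInstance
  have hL : (Q.obj S.X₃).IsLE (i - 2) := inferInstance
  obtain ⟨B, ⟨e'⟩⟩ := exists_iso_singleFunctor_obj_of_isGE_of_isLE (Q.obj S.X₃) (i - 2)
  have hz : S.f ≫ g = 0 := by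
    ext j
    by_cases hj : j < i - 1
    · exact (S.X₁.isZero_of_isStrictlyGE (i - 1) j hj).eq_of_src _ _
    · exact (K.isZero_of_isStrictlyLE (i - 2) j (by lia)).eq_of_tgt _ _
  have := hS.epi_g
  have hg : S.g ≫ hS.exact.desc g hz = g := hS.exact.g_desc g hz
  generalize inv (Q.map s) = τ
  have h0 := hom_single_zero hH A B i (i - 2) (by lia) (e0.hom ≫ τ ≫ Q.map S.g ≫ e'.hom)
  rw [← hg, Q.map_comp]
  rw [← cancel_mono e'.inv, ← cancel_epi e0.inv] at h0
  simp only [Category.assoc, Iso.hom_inv_id, Iso.inv_hom_id_assoc, comp_zero, Category.comp_id, zero_comp] at h0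
  rw [reassoc_of% h0, zero_comp]

/-- Dual statement. -/
lemma hom_to_single_zero (hH : Hereditary C) (A : C) (i : ℤ) (Y : DerivedCategory C)
    (hY : Y.IsGE (i + 2)) (f : Y ⟶ (singleFunctor C i).obj A) : f = 0 := by
  obtain ⟨K, hK, ⟨e⟩⟩ := exists_iso_Q_obj_of_isGE Y (i + 2)
  let e0 : (singleFunctor C i).obj A ≅ Q.obj ((CochainComplex.singleFunctor C i).obj A) :=
    (singleFunctorIsoCompQ C i).app A
  rw [← cancel_epi e.inv, comp_zero, ← cancel_mono e0.hom, zero_comp]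
  generalize (e.inv ≫ f) ≫ e0.hom = φ
  obtain ⟨P, hP, g, s, hs, rfl⟩ := left_fac_of_isStrictlyGE φ i
  have hPi : (Q.obj P).IsLE i :=
    TStructure.t.isLE_of_iso (asIso (Q.map s)) i
  obtain ⟨S, hS, rfl, h₁, h₃⟩ := exists_brutal_ses P (i + 1) (i + 2) (by lia)
  have hT := triangleOfSES_distinguished hS
  have hL : (Q.obj S.X₁).IsLE (i + 2) := by
    refine isLE₂ _ (inv_rot_of_distTriang _ hT) (i + 2) ?_ ?_
    · exact TStructure.t.isLE_shift (Q.obj S.X₃) (i + 1) (-1) (i + 2) (by lia)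
    · exact TStructure.t.isLE_of_le (Q.obj S.X₂) i (i + 2)
  have hG : (Q.obj S.X₁).IsGE (i + 2) := inferInstance
  obtain ⟨B, ⟨e'⟩⟩ := exists_iso_singleFunctor_obj_of_isGE_of_isLE (Q.obj S.X₁) (i + 2)
  have hz : g ≫ S.g = 0 := by
    ext j
    by_cases hj : j < i + 2
    · exact (K.isZero_of_isStrictlyGE (i + 2) j hj).eq_of_src _ _
    · exact (S.X₃.isZero_of_isStrictlyLE (i + 1) j (by lia)).eq_of_tgt _ _
  have := hS.mono_f
  have hg : hS.exact.lift g hz ≫ S.f = g := hS.exact.lift_f g hz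
  generalize inv (Q.map s) = τ
  have h0 := hom_single_zero hH B A (i + 2) i (by lia) (e'.inv ≫ Q.map S.f ≫ τ ≫ e0.inv)
  rw [← hg, Q.map_comp]
  rw [← cancel_epi e'.hom, ← cancel_mono e0.hom] at h0
  simp only [Category.assoc, Iso.inv_hom_id, Category.comp_id, Iso.hom_inv_id_assoc, comp_zero, zero_comp] at h0
  rw [Category.assoc, h0, comp_zero]

/-- homology of a triangle whose third object has no homology around degree `i` -/
lemma isIso_mor₁ (T : Triangle (DerivedCategory C)) (hT : T ∈ distTriang _) (i : ℤ)
    (h : IsZero ((homologyFunctor C (i - 1)).obj T.obj₃))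
    (h' : IsZero ((homologyFunctor C i).obj T.obj₃)) :
    IsIso ((homologyFunctor C i).map T.mor₁) := by
  have := (HomologySequence.epi_homologyMap_mor₁_iff T hT i).2 (h'.eq_of_tgt _ _)
  have := (HomologySequence.mono_homologyMap_mor₁_iff T hT (i - 1) i (by lia)).2
    (h.eq_of_src _ _)
  exact isIso_of_mono_of_epi _

lemma isIso_mor₂ (T : Triangle (DerivedCategory C)) (hT : T ∈ distTriang _) (i : ℤ)
    (h : IsZero ((homologyFunctor C i).obj T.obj₁))
    (h' : IsZero ((homologyFunctor C (i + 1)).obj T.obj₁)) :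
    IsIso ((homologyFunctor C i).map T.mor₂) := by
  have := (HomologySequence.mono_homologyMap_mor₂_iff T hT i).2 (h.eq_of_src _ _)
  have := (HomologySequence.epi_homologyMap_mor₂_iff T hT i (i + 1) (by lia)).2
    (h'.eq_of_tgt _ _)
  exact isIso_of_mono_of_epi _

lemma exists_section (hH : Hereditary C) (X : DerivedCategory C) (i : ℤ) :
    ∃ (A : C) (s : (singleFunctor C i).obj A ⟶ X), IsIso ((homologyFunctor C i).map s) := by
  obtain ⟨X₁, X₂, h₁, h₂, a, b, c, hT⟩ :=
    TStructure.t.exists_triangle X i (i + 1) rfl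
  obtain ⟨X₃, X₄, h₃, h₄, a', q, c', hT'⟩ :=
    TStructure.t.exists_triangle X₁ (i - 1) i (by lia)
  have h₁ : X₁.IsLE i := ⟨h₁⟩
  have h₂ : X₂.IsGE (i + 1) := ⟨h₂⟩
  have h₃ : X₃.IsLE (i - 1) := ⟨h₃⟩
  have h₄ : X₄.IsGE i := ⟨h₄⟩
  have h₃' : (X₃⟦(1 : ℤ)⟧).IsLE (i - 2) := isLE_shift_one X₃ (i - 1) (i - 2) (by lia) h₃
  have h₄' : X₄.IsLE i := isLE₂ _ (rot_of_distTriang _ hT') i h₁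
    (TStructure.t.isLE_of_le (X₃⟦(1 : ℤ)⟧) (i - 2) i)
  obtain ⟨A, ⟨e⟩⟩ := exists_iso_singleFunctor_obj_of_isGE_of_isLE X₄ i
  have hz := hom_from_single_zero hH A i _ h₃' (e.inv ≫ c')
  obtain ⟨s, hs⟩ : ∃ s : _ ⟶ X₁, e.inv = s ≫ q := Triangle.coyoneda_exact₃ _ hT' e.inv hz
  have i₁ : IsIso ((homologyFunctor C i).map a) := isIso_mor₁ _ hT i (X₂.isZero_of_isGE (i + 1) (i - 1) (by lia))
    (X₂.isZero_of_isGE (i + 1) i (by lia))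
  have i₂ : IsIso ((homologyFunctor C i).map q) := isIso_mor₂ _ hT' i (X₃.isZero_of_isLE (i - 1) i (by lia))
    (X₃.isZero_of_isLE (i - 1) (i + 1) (by lia))
  have i₃ : IsIso ((homologyFunctor C i).map s ≫ (homologyFunctor C i).map q) := by
    rw [← Functor.map_comp, ← hs]; infer_instance
  have i₄ : IsIso ((homologyFunctor C i).map s) :=
    IsIso.of_isIso_comp_right _ ((homologyFunctor C i).map q)
  exact ⟨A, s ≫ a, by rw [Functor.map_comp]; infer_instance⟩

lemma exists_retraction (hH : Hereditary C) (X : DerivedCategory C) (i : ℤ) :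
    ∃ (A : C) (p : X ⟶ (singleFunctor C i).obj A), IsIso ((homologyFunctor C i).map p) := by
  obtain ⟨X₁, X₂, h₁, h₂, a, b, c, hT⟩ :=
    TStructure.t.exists_triangle X (i - 1) i (by lia)
  obtain ⟨X₃, X₄, h₃, h₄, j, b', c', hT'⟩ :=
    TStructure.t.exists_triangle X₂ i (i + 1) (by lia)
  have h₁ : X₁.IsLE (i - 1) := ⟨h₁⟩
  have h₂ : X₂.IsGE i := ⟨h₂⟩
  have h₃ : X₃.IsLE i := ⟨h₃⟩
  have h₄ : X₄.IsGE (i + 1) := ⟨h₄⟩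
  have h₄' : (X₄⟦(-1 : ℤ)⟧).IsGE (i + 2) := TStructure.t.isGE_shift X₄ (i + 1) (-1) (i + 2) (by lia)
  have h₃' : X₃.IsGE i := isGE₂ _ (inv_rot_of_distTriang _ hT') i
    (TStructure.t.isGE_of_ge (X₄⟦(-1 : ℤ)⟧) i (i + 2)) h₂
  obtain ⟨A, ⟨e⟩⟩ := exists_iso_singleFunctor_obj_of_isGE_of_isLE X₃ i
  have hz := hom_to_single_zero hH A i _ h₄' ((Triangle.mk j b' c').invRotate.mor₁ ≫ e.hom)
  obtain ⟨p, hp⟩ : ∃ p : X₂ ⟶ _, e.hom = j ≫ p := Triangle.yoneda_exact₂ _ (inv_rot_of_distTriang _ hT') e.hom hz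
  have i₁ : IsIso ((homologyFunctor C i).map b) := isIso_mor₂ _ hT i (X₁.isZero_of_isLE (i - 1) i (by lia))
    (X₁.isZero_of_isLE (i - 1) (i + 1) (by lia))
  have i₂ : IsIso ((homologyFunctor C i).map j) := isIso_mor₁ _ hT' i (X₄.isZero_of_isGE (i + 1) (i - 1) (by lia))
    (X₄.isZero_of_isGE (i + 1) i (by lia))
  have i₃ : IsIso ((homologyFunctor C i).map j ≫ (homologyFunctor C i).map p) := by
    rw [← Functor.map_comp, ← hp]; infer_instance
  have i₄ : IsIso ((homologyFunctor C i).map p) :=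
    IsIso.of_isIso_comp_left ((homologyFunctor C i).map j) _
  exact ⟨A, b ≫ p, by rw [Functor.map_comp]; infer_instance⟩

/-- A nonzero object of the derived category of a hereditary category has a nonzero stalk
complex as a direct summand. -/
lemma exists_summand (hH : Hereditary C) (X : DerivedCategory C) (hX : ¬ IsZero X) :
    ∃ (i : ℤ) (A : C) (s : (singleFunctor C i).obj A ⟶ X) (p : X ⟶ (singleFunctor C i).obj A),
      s ≫ p = 𝟙 _ ∧ ¬ IsZero ((singleFunctor C i).obj A) := by
  obtain ⟨i, hi⟩ : ∃ i, ¬ IsZero ((homologyFunctor C i).obj X) := by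
    by_contra! h
    have h1 : X.IsGE 1 := (isGE_iff X 1).2 (fun i _ => h i)
    have h0 : X.IsLE 0 := (isLE_iff X 0).2 (fun i _ => h i)
    exact hX (TStructure.t.isZero X 0 1)
  obtain ⟨A, s, hs⟩ := exists_section hH X i
  obtain ⟨B, p, hp⟩ := exists_retraction hH X i
  have hsp : IsIso (s ≫ p) := by
    rw [isIso_iff]
    intro n
    rcases lt_trichotomy n i with hn | rfl | hn
    · exact ⟨0, (isZero_of_isGE _ i n hn).eq_of_src _ _, (isZero_of_isGE _ i n hn).eq_of_src _ _⟩
    · rw [Functor.map_comp]; infer_instance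
    · exact ⟨0, (isZero_of_isLE _ i n hn).eq_of_src _ _, (isZero_of_isLE _ i n hn).eq_of_src _ _⟩
  refine ⟨i, A, s, p ≫ inv (s ≫ p), by rw [← Category.assoc]; simp, fun hz => hi ?_⟩
  exact ((homologyFunctor C i).map_isZero hz).of_iso
    (asIso ((homologyFunctor C i).map s)).symm

end Hered

section Abelian

variable {C : Type u} [Category.{v} C] [Abelian C]

lemma idem_of_indecomposable {Q : C} (hQ : Indecomposable Q) (e : Q ⟶ Q) (he : e ≫ e = e) :
    e = 0 ∨ e = 𝟙 Q := by
  have h1 : (𝟙 Q - e) ≫ e = 0 := by simp [he]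
  have h2 : e ≫ (𝟙 Q - e) = 0 := by simp [he]
  let φ : Q ≅ kernel e ⊞ kernel (𝟙 Q - e) :=
    { hom := biprod.lift (kernel.lift e (𝟙 Q - e) h1) (kernel.lift (𝟙 Q - e) e h2)
      inv := biprod.desc (kernel.ι _) (kernel.ι _)
      hom_inv_id := by simp [biprod.lift_desc]
      inv_hom_id := by
        have a : kernel.ι (𝟙 Q - e) ≫ e = kernel.ι (𝟙 Q - e) := by
          have := kernel.condition (𝟙 Q - e)
          rw [Preadditive.comp_sub, Category.comp_id, sub_eq_zero] at this
          exact this.symm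
        ext <;> simp [a] }
  rcases hQ.2 _ _ φ with h | h
  · right
    have := kernel.lift_ι e (𝟙 Q - e) h1
    rw [h.eq_of_src (kernel.ι e) 0, comp_zero] at this
    exact (sub_eq_zero.1 this.symm).symm
  · left
    have := kernel.lift_ι (𝟙 Q - e) e h2
    rw [h.eq_of_src (kernel.ι (𝟙 Q - e)) 0, comp_zero] at this
    exact this.symm

lemma simple_cokernel {X : C} (U V : Subobject X) (h : U ⋖ V) :
    Simple (cokernel (Subobject.ofLE U V h.le)) := by
  refine ⟨fun {Z} m _ => ⟨fun hm h0 => ?_, fun h0 => ?_⟩⟩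
  · subst h0
    have hz : IsZero (cokernel (Subobject.ofLE U V h.le)) := by
      rw [IsZero.iff_id_eq_zero, ← IsIso.inv_hom_id (0 : Z ⟶ _), comp_zero]
    have : Epi (Subobject.ofLE U V h.le) :=
      Preadditive.epi_of_cokernel_zero (hz.eq_of_tgt _ _)
    have : IsIso (Subobject.ofLE U V h.le) := isIso_of_mono_of_epi _
    refine h.lt.not_ge (Subobject.le_of_comm (inv (Subobject.ofLE U V h.le)) ?_)
    rw [IsIso.inv_comp_eq, Subobject.ofLE_arrow]
  · let π := cokernel.π (Subobject.ofLE U V h.le)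
    let a := pullback.fst m π
    let b := pullback.snd m π
    have hab : a ≫ m = b ≫ π := pullback.condition
    let W : Subobject X := Subobject.mk (b ≫ V.arrow)
    have hUW : U ≤ W := by
      refine Subobject.le_mk_of_comm (pullback.lift 0 (Subobject.ofLE U V h.le) (by simp [π])) ?_
      have hl : pullback.lift 0 (Subobject.ofLE U V h.le) (by simp [π]) ≫ b =
          Subobject.ofLE U V h.le := pullback.lift_snd (f := m) (g := π) _ _ _
      rw [reassoc_of% hl, Subobject.ofLE_arrow]
    have hWV : W ≤ V := Subobject.mk_le_of_comm b rfl
    rcases h.eq_or_eq hUW hWV with hW | hW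
    · exfalso
      apply h0
      have hle : W ≤ U := hW.le
      let c : pullback m π ⟶ (U : C) := Subobject.ofMkLE (b ≫ V.arrow) U hle
      have hc : c ≫ Subobject.ofLE U V h.le = b := by
        rw [← cancel_mono V.arrow]
        simp [c]
      have : a ≫ m = 0 := by
        rw [hab, ← hc, Category.assoc, cokernel.condition, comp_zero]
      rw [← cancel_epi a, this, comp_zero]
    · have hle : V ≤ W := hW.ge
      let c : (V : C) ⟶ pullback m π := Subobject.ofLEMk V (b ≫ V.arrow) hle
      have hc : c ≫ b = 𝟙 _ := by
        rw [← cancel_mono V.arrow]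
        simp [c]
      have hπ : (c ≫ a) ≫ m = π := by
        rw [Category.assoc, hab, reassoc_of% hc]
      have : Epi ((c ≫ a) ≫ m) := by rw [hπ]; infer_instance
      have : Epi m := epi_of_epi (c ≫ a) m
      exact isIso_of_mono_of_epi m

/-- Devissage along composition series. -/
lemma devissage (hfl : FiniteLength C) (P : C → Prop) (h0 : ∀ X, IsZero X → P X)
    (hs : ∀ X, Simple X → P X)
    (hext : ∀ S : ShortComplex C, S.ShortExact → P S.X₁ → P S.X₃ → P S.X₂)
    (hiso : ∀ X Y : C, (X ≅ Y) → P X → P Y) (X : C) : P X := by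
  obtain ⟨n, f, hf0, hf1, hf⟩ := hfl X
  have key : ∀ k : Fin (n + 1), P (f k : C) := by
    intro k
    induction k using Fin.induction with
    | zero =>
      apply h0
      rw [hf0]
      exact (isZero_zero C).of_iso Subobject.botCoeIsoZero
    | succ k ih =>
      let i := Subobject.ofLE (f k.castSucc) (f k.succ) (hf k).le
      let S := ShortComplex.mk i (cokernel.π i) (cokernel.condition i)
      have hS : S.ShortExact :=
        { exact := ShortComplex.exact_of_g_is_cokernel S (cokernelIsCokernel i)
          mono_f := by dsimp [S, i]; infer_instance
          epi_g := by dsimp [S]; infer_instance }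
      exact hext S hS ih (hs _ (simple_cokernel _ _ (hf k)))
  have := key (Fin.last n)
  rw [hf1] at this
  exact hiso _ _ (asIso (⊤ : Subobject X).arrow) this

end Abelian

section Ext

open DerivedCategory Pretriangulated

variable {C : Type u} [Category.{v} C] [Abelian C] [HasDerivedCategory.{w} C]

lemma exists_simple_left (hfl : FiniteLength C) (X Y : C) (d : ℤ) (h : extNonzero C X Y d) :
    ∃ S : C, Indecomposable S ∧ extNonzero C S Y d := by
  by_contra! hc
  obtain ⟨g, hg⟩ := h
  refine hg ?_
  refine devissage hfl
    (fun X => ∀ g : (singleFunctor C 0).obj X ⟶ ((singleFunctor C 0).obj Y)⟦d⟧, g = 0)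
    ?_ ?_ ?_ ?_ X g
  · intro X hX g
    exact ((singleFunctor C 0).map_isZero hX).eq_of_src _ _
  · intro X hX g
    by_contra hg
    exact hc X (indecomposable_of_simple X) ⟨g, hg⟩
  · intro S hS h1 h3 g
    obtain ⟨k, hk⟩ := Triangle.yoneda_exact₂ _ hS.singleTriangle_distinguished g (h1 _)
    have hk0 : k = 0 := h3 k
    rw [hk, hk0]
    exact comp_zero
  · intro X Y e h g
    rw [← cancel_epi ((singleFunctor C 0).mapIso e).hom, comp_zero]
    exact h _

lemma exists_simple_right (hfl : FiniteLength C) (X Y : C) (d : ℤ) (h : extNonzero C X Y d) :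
    ∃ S : C, Indecomposable S ∧ extNonzero C X S d := by
  by_contra! hc
  obtain ⟨g, hg⟩ := h
  refine hg ?_
  refine devissage hfl
    (fun Y => ∀ g : (singleFunctor C 0).obj X ⟶ ((singleFunctor C 0).obj Y)⟦d⟧, g = 0)
    ?_ ?_ ?_ ?_ Y g
  · intro Y hY g
    exact ((singleFunctor C 0 ⋙ shiftFunctor (DerivedCategory C) d).map_isZero hY).eq_of_tgt _ _
  · intro Y hY g
    by_contra hg
    exact hc Y (indecomposable_of_simple Y) ⟨g, hg⟩
  · intro S hS h1 h3 g
    have hT := Triangle.shift_distinguished _ hS.singleTriangle_distinguished d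
    obtain ⟨k, hk⟩ := Triangle.coyoneda_exact₂ _ hT g (h3 _)
    have hk0 : k = 0 := h1 k
    rw [hk, hk0]
    exact zero_comp
  · intro Y Z e h g
    rw [← cancel_mono ((singleFunctor C 0 ⋙ shiftFunctor (DerivedCategory C) d).mapIso e).inv,
      zero_comp]
    exact h _

lemma extNonzero_zero_of_hom {X Y : C} (g : X ⟶ Y) (hg : g ≠ 0) : extNonzero C X Y 0 := by
  refine ⟨(singleFunctor C 0).map g ≫ (shiftFunctorZero (DerivedCategory C) ℤ).inv.app _, ?_⟩
  intro h
  rw [← cancel_mono ((shiftFunctorZero (DerivedCategory C) ℤ).hom.app _)] at h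
  apply hg
  apply (singleFunctor C 0).map_injective
  simpa using h

end Ext

section Degree

open DerivedCategory

variable {C : Type u} [Category.{v} C] [Abelian C] [HasDerivedCategory.{w} C]
  {H : Type u'} [Category.{v'} H] [Abelian H] [HasDerivedCategory.{w'} H]

/-- The image of `Q` under the equivalence is a stalk complex in degree `i`. -/
def IsDeg (E : TriangulatedEquivalence C H) (Q : C) (i : ℤ) : Prop :=
  ∃ A : H, Nonempty (E.functor.obj ((singleFunctor C 0).obj Q) ≅ (singleFunctor H i).obj A)

lemma exists_isDeg (E : TriangulatedEquivalence C H) (hH : Hereditary H) (Q : C)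
    (hQ : Indecomposable Q) : ∃ i, IsDeg E Q i := by
  have := E.isEquivalence
  have hZ : ¬ IsZero (E.functor.obj ((singleFunctor C 0).obj Q)) := by
    intro h
    apply hQ.1
    rw [IsZero.iff_id_eq_zero]
    apply (singleFunctor C 0).map_injective
    apply E.functor.map_injective
    exact h.eq_of_src _ _
  obtain ⟨i, A, s, p, hsp, hA⟩ := exists_summand hH _ hZ
  refine ⟨i, A, ⟨⟨p, s, ?_, hsp⟩⟩⟩
  obtain ⟨e₁, he₁⟩ := E.functor.map_surjective (p ≫ s)
  obtain ⟨e, rfl⟩ := (singleFunctor C 0).map_surjective e₁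
  have he : e ≫ e = e := by
    apply (singleFunctor C 0).map_injective
    apply E.functor.map_injective
    simp only [Functor.map_comp, he₁, Category.assoc, reassoc_of% hsp]
  rcases idem_of_indecomposable hQ e he with rfl | rfl
  · exfalso
    apply hA
    rw [IsZero.iff_id_eq_zero]
    have h0 : p ≫ s = 0 := by rw [← he₁]; simp
    rw [← hsp, ← Category.comp_id p, ← hsp, reassoc_of% h0]
    simp
  · rw [← he₁]; simp

lemma deg_bound (E : TriangulatedEquivalence C H) (hH : Hereditary H) {Q Q' : C} {i j d : ℤ}
    (hi : IsDeg E Q i) (hj : IsDeg E Q' j) (h : extNonzero C Q Q' d) :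
    i - 1 ≤ j - d ∧ j - d ≤ i := by
  have := E.isEquivalence
  let _ := E.commShift
  obtain ⟨A, ⟨a⟩⟩ := hi
  obtain ⟨B, ⟨b⟩⟩ := hj
  obtain ⟨g, hg⟩ := h
  let e : E.functor.obj (((singleFunctor C 0).obj Q')⟦d⟧) ≅ (singleFunctor H (j - d)).obj B :=
    (E.functor.commShiftIso d).app _ ≪≫ (shiftFunctor (DerivedCategory H) d).mapIso b ≪≫
      singleShift d (j - d) j (by lia) B
  have hf : a.inv ≫ E.functor.map g ≫ e.hom ≠ 0 := by
    intro h0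
    rw [← cancel_epi a.hom, ← cancel_mono e.inv] at h0
    simp only [Category.assoc, Iso.hom_inv_id_assoc, Iso.hom_inv_id, Category.comp_id,
      comp_zero, zero_comp] at h0
    exact hg (E.functor.map_injective (by simpa using h0))
  constructor
  · by_contra hc
    exact hf (hom_single_zero hH A B i (j - d) (by lia) _)
  · by_contra hc
    exact hf (TStructure.t.zero _ i (j - d) (by lia))

lemma path_bound (E : TriangulatedEquivalence C H) (hH : Hereditary H) {r : ℕ} {ε : Fin r → ℤ}
    (hε : ∀ i, ε i = 1 ∨ ε i = -1) {Q₀ Q Q' : C} (h : EpsPath C ε Q₀ Q) (h' : EpsPath C ε Q₀ Q')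
    (deg : C → ℤ) (hdeg : ∀ X, Indecomposable X → IsDeg E X (deg X)) : deg Q - deg Q' ≤ r := by
  obtain ⟨c, c0, c1, ci, cs⟩ := h
  obtain ⟨c', c0', c1', ci', cs'⟩ := h'
  have key : ∀ k : Fin (r + 1), deg (c k) - deg (c' k) ≤ (k : ℕ) := by
    intro k
    induction k using Fin.induction with
    | zero => rw [c0, c0']; simp
    | succ k ih =>
      have ek : ((k.succ : Fin (r + 1)) : ℕ) = (k.castSucc : ℕ) + 1 := by simp
      rcases hε k with hk | hk
      · obtain ⟨g, hg⟩ := (cs k).1 hk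
        obtain ⟨g', hg'⟩ := (cs' k).1 hk
        have a1 := deg_bound E hH (hdeg _ (ci _)) (hdeg _ (ci _)) (extNonzero_zero_of_hom g hg)
        have a2 := deg_bound E hH (hdeg _ (ci' _)) (hdeg _ (ci' _))
          (extNonzero_zero_of_hom g' hg')
        rw [ek]
        push_cast
        linarith [a1.1, a1.2, a2.1, a2.2]
      · obtain ⟨g, hg⟩ := (cs k).2 hk
        obtain ⟨g', hg'⟩ := (cs' k).2 hk
        have a1 := deg_bound E hH (hdeg _ (ci _)) (hdeg _ (ci _)) (extNonzero_zero_of_hom g hg)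
        have a2 := deg_bound E hH (hdeg _ (ci' _)) (hdeg _ (ci' _))
          (extNonzero_zero_of_hom g' hg')
        rw [ek]
        push_cast
        linarith [a1.1, a1.2, a2.1, a2.2]
  have := key (Fin.last r)
  rw [c1, c1'] at this
  simpa using this

end Degree

theorem gldim_le_of_epsPath_from_indecomposable
    (hfl : FiniteLength 𝒜) (hph : IsPiecewiseHereditary.{w, w', v, u, v', u'} 𝒜)
    (r : ℕ) (hr : 1 ≤ r) (ε : Fin r → ℤ) (hε : ∀ i, ε i = 1 ∨ ε i = -1)
    (Q₀ : 𝒜) (hQ₀ : Indecomposable Q₀)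
    (hpath : ∀ Q : 𝒜, Indecomposable Q → EpsPath 𝒜 ε Q₀ Q) :
    gldim 𝒜 ≤ (r : ℕ∞) + 1 ∧
      ∀ Q : 𝒜, Indecomposable Q → projDim 𝒜 Q + injDim 𝒜 Q ≤ (r : ℕ∞) + 2 := by
  obtain ⟨H, _, _, _, hH, ⟨E⟩⟩ := hph
  have hex : ∀ X : 𝒜, ∃ i : ℤ, Indecomposable X → IsDeg E X i := by
    intro X
    by_cases hX : Indecomposable X
    · obtain ⟨i, hi⟩ := exists_isDeg E hH X hX
      exact ⟨i, fun _ => hi⟩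
    · exact ⟨0, fun h => absurd h hX⟩
  choose deg hdeg using hex
  have hpb : ∀ X Y : 𝒜, Indecomposable X → Indecomposable Y → deg X - deg Y ≤ r :=
    fun X Y hX hY => path_bound E hH hε (hpath X hX) (hpath Y hY) deg hdeg
  refine ⟨iSup_le fun X => iSup₂_le fun d hd => ?_, fun Q hQ => ?_⟩
  · obtain ⟨Y, hY⟩ := hd
    obtain ⟨S, hS, hSY⟩ := exists_simple_left hfl _ _ _ hY
    obtain ⟨T, hT, hST⟩ := exists_simple_right hfl _ _ _ hSY
    have h1 := deg_bound E hH (hdeg _ hS) (hdeg _ hT) hST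
    have h2 := hpb T S hT hS
    have h3 : d ≤ r + 1 := by lia
    exact_mod_cast h3
  · have hid : extNonzero 𝒜 Q Q 0 :=
      extNonzero_zero_of_hom (𝟙 Q) (fun h => hQ.1 ((IsZero.iff_id_eq_zero Q).2 h))
    have hde : ∀ d e : ℕ, (∃ Q', extNonzero 𝒜 Q Q' d) → (∃ Q', extNonzero 𝒜 Q' Q e) →
        d + e ≤ r + 2 := by
      rintro d e ⟨Y, hY⟩ ⟨X, hX⟩
      obtain ⟨T, hT, hQT⟩ := exists_simple_right hfl _ _ _ hY
      obtain ⟨S, hS, hSQ⟩ := exists_simple_left hfl _ _ _ hX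
      have h1 := deg_bound E hH (hdeg _ hQ) (hdeg _ hT) hQT
      have h2 := deg_bound E hH (hdeg _ hS) (hdeg _ hQ) hSQ
      have h3 := hpb T S hT hS
      lia
    have hp : ∀ e : ℕ, (∃ Q', extNonzero 𝒜 Q' Q e) →
        projDim 𝒜 Q ≤ ((r + 2 - e : ℕ) : ℕ∞) := by
      intro e he
      refine iSup₂_le fun d hd => ?_
      have := hde d e hd he
      have h3 : d ≤ r + 2 - e := by lia
      exact_mod_cast h3
    have hp0 := hp 0 ⟨Q, hid⟩
    obtain ⟨p, hpp⟩ := ENat.ne_top_iff_exists.1 (ne_top_of_le_ne_top (ENat.natCast_ne_top _) hp0)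
    rw [← hpp] at hp hp0 ⊢
    have hp0' : p ≤ r + 2 := by exact_mod_cast hp0
    have hi : injDim 𝒜 Q ≤ ((r + 2 - p : ℕ) : ℕ∞) := by
      refine iSup₂_le fun e he => ?_
      have h4 : p ≤ r + 2 - e := by exact_mod_cast hp e he
      have h5 := hde 0 e ⟨Q, hid⟩ he
      have h3 : e ≤ r + 2 - p := by lia
      exact_mod_cast h3
    calc (p : ℕ∞) + injDim 𝒜 Q ≤ p + ((r + 2 - p : ℕ) : ℕ∞) := by gcongr
      _ = ((p + (r + 2 - p) : ℕ) : ℕ∞) := by push_cast; rfl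
      _ = (r : ℕ∞) + 2 := by rw [Nat.add_sub_cancel' hp0']; push_cast; rfl

end PiecewiseHereditaryPaper
end

section
/- Let 𝒜 be an abelian category, ℋ a hereditary abelian category, and F : D^b(𝒜) → D^b(ℋ) a triangulated equivalence; for each indecomposable Q of 𝒜 write F(Q[0]) ≅ f(Q)[n(Q)]. If Q, Q' are indecomposables of 𝒜 with Hom_𝒜(Q, Q') ≠ 0, then n(Q') − n(Q) ∈ {0, 1}. -/
/-!
Statement 6: if `Q, Q'` are indecomposables of `𝒜` with `Hom_𝒜(Q,Q') ≠ 0`,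
then `n(Q') − n(Q) ∈ {0, 1}`.
-/

open CategoryTheory CategoryTheory.Limits

universe w w' v u v' u'

namespace PiecewiseHereditaryPaper

variable (𝒜 : Type u) [Category.{v} 𝒜] [Abelian 𝒜] [HasDerivedCategory.{w} 𝒜]

variable (ℋ : Type u') [Category.{v'} ℋ] [Abelian ℋ] [HasDerivedCategory.{w'} ℋ]

theorem not_extNonzero_of_neg (X Y : ℋ) (d : ℤ) (hd : d < 0) : ¬ extNonzero ℋ X Y d := by
  rintro ⟨g, hg⟩
  apply hg
  have h1 : (DerivedCategory.TStructure.t (C := ℋ)).IsGE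
      (((DerivedCategory.singleFunctor ℋ 0).obj Y)⟦d⟧) (-d) :=
    (DerivedCategory.TStructure.t (C := ℋ)).isGE_shift _ 0 d (-d) (by omega)
  exact (DerivedCategory.TStructure.t (C := ℋ)).zero g 0 (-d) (by omega)

theorem n_diff_mem_zero_one_of_hom_ne_zero
    (hH : Hereditary ℋ)
    (F : DerivedCategory 𝒜 ⥤ DerivedCategory ℋ)
    [F.IsEquivalence] [F.CommShift ℤ] [F.IsTriangulated]
    (f : 𝒜 → ℋ) (n : 𝒜 → ℤ)
    (hfn : ∀ Q : 𝒜, Indecomposable Q → Indecomposable (f Q) ∧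
      Nonempty (F.obj ((DerivedCategory.singleFunctor 𝒜 0).obj Q) ≅
        (((DerivedCategory.singleFunctor ℋ 0).obj (f Q))⟦n Q⟧)))
    (Q Q' : 𝒜) (hQ : Indecomposable Q) (hQ' : Indecomposable Q')
    (hhom : ∃ g : Q ⟶ Q', g ≠ 0) :
    n Q' - n Q = 0 ∨ n Q' - n Q = 1 := by
  obtain ⟨g, hg⟩ := hhom
  obtain ⟨-, ⟨e⟩⟩ := hfn Q hQ
  obtain ⟨-, ⟨e'⟩⟩ := hfn Q' hQ'
  have key : extNonzero ℋ (f Q) (f Q') (n Q' - n Q) := by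
    by_contra hcon
    apply hg
    apply (DerivedCategory.singleFunctor 𝒜 0).map_injective
    apply F.map_injective
    rw [Functor.map_zero, Functor.map_zero]
    -- the transported morphism
    let i := (shiftFunctorAdd' (DerivedCategory ℋ) (n Q' - n Q) (n Q) (n Q') (by omega)).app
      ((DerivedCategory.singleFunctor ℋ 0).obj (f Q'))
    let φ := e.inv ≫ F.map ((DerivedCategory.singleFunctor 𝒜 0).map g) ≫ e'.hom ≫ i.hom
    obtain ⟨ψ, hψ⟩ := (shiftFunctor (DerivedCategory ℋ) (n Q)).map_surjective φ
    have h0 : ψ = 0 := by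
      by_contra h
      exact hcon ⟨ψ, h⟩
    have hφ : φ = 0 := by rw [← hψ, h0, Functor.map_zero]
    have : F.map ((DerivedCategory.singleFunctor 𝒜 0).map g) = e.hom ≫ φ ≫ i.inv ≫ e'.inv := by
      simp [φ]
    rw [this, hφ, zero_comp, comp_zero]
  have h1 : ¬ (n Q' - n Q < 0) := fun h => not_extNonzero_of_neg ℋ _ _ _ h key
  have h2 : ¬ (2 ≤ n Q' - n Q) := fun h => by
    refine hH (f Q) (f Q') (n Q' - n Q).toNat (by omega) ?_
    rwa [Int.toNat_of_nonneg (by omega)]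
  omega

end PiecewiseHereditaryPaper
end
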